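/- (Abstract MQSD inf-sup stability, structural form of Theorem 5.4.) Let V be a real vector space, a : V × V → ℝ a bilinear form, and m, σ : V × V → ℝ symmetric positive semidefinite bilinear forms (m(v,v) ≥ 0 and σ(v,v) ≥ 0 for all v). Define N_MQ(v) := √(m(v,v)) and N_MQSD(v) := √(m(v,v) + σ(v,v)). Assume: (i) a(v, v) = m(v, v) for all v ∈ V; (ii) there exist constants C₄ ≥ 0 and C_z ≥ 0 such that for every u ∈ V there is z ∈ V with a(u, z) ≥ (1/4) σ(u, u) - C₄ m(u, u) and N_MQSD(z) ≤ C_z N_MQSD(u). Then for every u ∈ V there exists v ∈ V such that a(u, v) ≥ N_MQSD(u)² and N_MQSD(v) ≤ (4 C_z + 1 + 4 C₄) N_MQSD(u); consequently the discrete inf-sup condition sup_v a(u,v)/N_MQSD(v) ≥ β N_MQSD(u) holds with β = 1/(4 C_z + 1 + 4 C₄). -/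

import Mathlib

/-- The seminorm attached to a symmetric positive semidefinite bilinear form is subadditive
and positively homogeneous. -/
theorem sqrt_bilin_smul_add_smul_le {V : Type*} [AddCommGroup V] [Module ℝ V]
    (B : V →ₗ[ℝ] V →ₗ[ℝ] ℝ) (hB_symm : ∀ u v, B u v = B v u) (hB_pos : ∀ v, 0 ≤ B v v)
    {s t : ℝ} (hs : 0 ≤ s) (ht : 0 ≤ t) (x y : V) :
    √(B (s • x + t • y) (s • x + t • y)) ≤ s * √(B x x) + t * √(B y y) := by
  have cauchy_schwarz : B x y ≤ √(B x x) * √(B y y) := by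
    rw [← Real.sqrt_mul (hB_pos x)]
    exact Real.le_sqrt_of_sq_le
      (LinearMap.BilinForm.apply_sq_le_of_symm B hB_pos ⟨hB_symm⟩ x y)
  refine Real.sqrt_le_iff.mpr ⟨by positivity, ?_⟩
  have hexpand : B (s • x + t • y) (s • x + t • y)
      = s ^ 2 * B x x + 2 * (s * t) * B x y + t ^ 2 * B y y := by
    simp only [map_add, map_smul, LinearMap.add_apply, LinearMap.smul_apply, smul_eq_mul,
      hB_symm y x]
    ring
  calc B (s • x + t • y) (s • x + t • y)
      = s ^ 2 * B x x + 2 * (s * t) * B x y + t ^ 2 * B y y := hexpand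
    _ ≤ s ^ 2 * B x x + 2 * (s * t) * (√(B x x) * √(B y y)) + t ^ 2 * B y y := by gcongr
    _ = s ^ 2 * √(B x x) ^ 2 + 2 * (s * t) * (√(B x x) * √(B y y))
          + t ^ 2 * √(B y y) ^ 2 := by
        rw [Real.sq_sqrt (hB_pos x), Real.sq_sqrt (hB_pos y)]
    _ = (s * √(B x x) + t * √(B y y)) ^ 2 := by ring

/-- Abstract MQSD inf-sup stability (structural form of Theorem 5.4): if
`a(v,v) = m(v,v)` and every `u` admits `z` with
`a(u,z) ≥ (1/4)σ(u,u) - C₄ m(u,u)` and `N_MQSD(z) ≤ C_z N_MQSD(u)`, then every `u`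
admits `v` with `a(u,v) ≥ N_MQSD(u)²`, `N_MQSD(v) ≤ (4C_z + 1 + 4C₄) N_MQSD(u)`,
and hence `a(u,v) ≥ β N_MQSD(u) N_MQSD(v)` with `β = 1/(4C_z + 1 + 4C₄)`. -/
theorem abstract_mqsd_inf_sup
    (V : Type*) [AddCommGroup V] [Module ℝ V]
    (a m σ : V →ₗ[ℝ] V →ₗ[ℝ] ℝ)
    (hm_symm : ∀ u v : V, m u v = m v u)
    (hm_pos : ∀ v : V, 0 ≤ m v v)
    (hσ_symm : ∀ u v : V, σ u v = σ v u)
    (hσ_pos : ∀ v : V, 0 ≤ σ v v)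
    (NMQ NMQSD : V → ℝ)
    (hNMQ : ∀ v, NMQ v = Real.sqrt (m v v))
    (hNMQSD : ∀ v, NMQSD v = Real.sqrt (m v v + σ v v))
    (hcoer : ∀ v : V, a v v = m v v)
    (C₄ Cz : ℝ) (hC₄ : 0 ≤ C₄) (hCz : 0 ≤ Cz)
    (hz : ∀ u : V, ∃ z : V,
      a u z ≥ (1 / 4) * σ u u - C₄ * m u u ∧ NMQSD z ≤ Cz * NMQSD u) :
    ∀ u : V, ∃ v : V,
      a u v ≥ (NMQSD u) ^ 2
      ∧ NMQSD v ≤ (4 * Cz + 1 + 4 * C₄) * NMQSD u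
      ∧ a u v ≥ (1 / (4 * Cz + 1 + 4 * C₄)) * (NMQSD u * NMQSD v) := by
  intro u
  obtain ⟨z, hz_lower, hz_norm⟩ := hz u
  have hpos : 0 < 4 * Cz + 1 + 4 * C₄ := by positivity
  have hN_nonneg : 0 ≤ NMQSD u := by rw [hNMQSD]; positivity
  have htriangle : NMQSD ((4 : ℝ) • z + (1 + 4 * C₄) • u)
      ≤ 4 * NMQSD z + (1 + 4 * C₄) * NMQSD u := by
    simpa only [hNMQSD, LinearMap.add_apply] using
      sqrt_bilin_smul_add_smul_le (m + σ)
        (fun x y => by simp only [LinearMap.add_apply, hm_symm x y, hσ_symm x y])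
        (fun x => add_nonneg (hm_pos x) (hσ_pos x))
        (by norm_num : (0 : ℝ) ≤ 4) (by positivity : 0 ≤ 1 + 4 * C₄) z u
  have hlower : NMQSD u ^ 2 ≤ a u ((4 : ℝ) • z + (1 + 4 * C₄) • u) := by
    rw [hNMQSD, Real.sq_sqrt (add_nonneg (hm_pos u) (hσ_pos u))]
    simp only [map_add, map_smul, smul_eq_mul, hcoer]
    linarith
  have hupper : NMQSD ((4 : ℝ) • z + (1 + 4 * C₄) • u)
      ≤ (4 * Cz + 1 + 4 * C₄) * NMQSD u := by
    linarith
  refine ⟨(4 : ℝ) • z + (1 + 4 * C₄) • u, hlower, hupper, le_trans ?_ hlower⟩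
  rw [one_div, inv_mul_le_iff₀ hpos]
  calc NMQSD u * NMQSD ((4 : ℝ) • z + (1 + 4 * C₄) • u)
      ≤ NMQSD u * ((4 * Cz + 1 + 4 * C₄) * NMQSD u) := by gcongr
    _ = (4 * Cz + 1 + 4 * C₄) * NMQSD u ^ 2 := by ring
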